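/- arXiv:1710.06744 — 3 statements merged into one kernel-verified Lean document; each statement's English description precedes it below -/
import Mathlib

section
/- In the category of sets, consider a commuting cube consisting of a top face with maps I → A, I → B, A → C, B → C, a bottom face with maps I' → A', I' → B', A' → C', B' → C', and vertical maps I → I', A → A', B → B', f : C → C'. Assume the top and bottom faces are pushouts, the face (I, B, I', B') is a pullback, and all arrows of the cube except possibly f are injective. Then f is injective and the face (A, C, A', C') is a pullback. -/
open CategoryTheory CategoryTheory.Limits

/-- In the category of sets, given a commuting cube whose top and
bottom faces are pushouts, whose face `(I, B, I', B')` is a pullback, and all of whose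
arrows except possibly `f : C ⟶ C'` are injective, the map `f` is injective and the
face `(A, C, A', C')` is a pullback. -/
theorem statement4 {I A B C I' A' B' C' : Type}
    (iA : I ⟶ A) (iB : I ⟶ B) (aC : A ⟶ C) (bC : B ⟶ C)
    (iA' : I' ⟶ A') (iB' : I' ⟶ B') (aC' : A' ⟶ C') (bC' : B' ⟶ C')
    (vI : I ⟶ I') (vA : A ⟶ A') (vB : B ⟶ B') (f : C ⟶ C')
    (hTop : IsPushout iA iB aC bC) (hBot : IsPushout iA' iB' aC' bC')
    (sqA : iA ≫ vA = vI ≫ iA') (sqB : iB ≫ vB = vI ≫ iB')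
    (sqC : aC ≫ f = vA ≫ aC') (sqD : bC ≫ f = vB ≫ bC')
    (hPB : IsPullback iB vI vB iB')
    (hiA : Function.Injective iA) (hiB : Function.Injective iB)
    (haC : Function.Injective aC) (hbC : Function.Injective bC)
    (hiA' : Function.Injective iA') (hiB' : Function.Injective iB')
    (haC' : Function.Injective aC') (hbC' : Function.Injective bC')
    (hvI : Function.Injective vI) (hvA : Function.Injective vA)
    (hvB : Function.Injective vB) :
    Function.Injective f ∧ IsPullback aC vA f aC' := by
  have eA (x) : vA (iA x) = iA' (vI x) := ConcreteCategory.congr_hom sqA x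
  have eC (x) : f (aC x) = aC' (vA x) := ConcreteCategory.congr_hom sqC x
  have eD (x) : f (bC x) = bC' (vB x) := ConcreteCategory.congr_hom sqD x
  have eTop (x) : aC (iA x) = bC (iB x) := ConcreteCategory.congr_hom hTop.w x
  have lift (a' : A') (b : B) (h : aC' a' = bC' (vB b)) :
      ∃ i, iB i = b ∧ iA' (vI i) = a' := by
    obtain ⟨i', rfl, hb⟩ :=
      Types.exists_of_isPullback (Types.isPullback_of_isPushout hBot hiA') a' (vB b) h
    obtain ⟨i, hi, rfl⟩ := Types.exists_of_isPullback hPB b i' hb.symm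
    exact ⟨i, hi, rfl⟩
  have meet (a : A) (b : B) (h : f (aC a) = f (bC b)) : aC a = bC b := by
    rw [eC, eD] at h
    obtain ⟨i, rfl, hi⟩ := lift _ _ h
    rw [← eTop, hvA ((eA i).trans hi)]
  refine ⟨fun x y h => ?_, (Types.isPullback_iff _ _ _ _).2
    ⟨sqC, fun x y h => haC h.1, fun c a' h => ?_⟩⟩
  · obtain ⟨x, rfl⟩ | ⟨x, rfl⟩ := Types.eq_or_eq_of_isPushout hTop x <;>
    obtain ⟨y, rfl⟩ | ⟨y, rfl⟩ := Types.eq_or_eq_of_isPushout hTop y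
    · rw [eC, eC] at h
      rw [hvA (haC' h)]
    · exact meet x y h
    · exact (meet y x h.symm).symm
    · rw [eD, eD] at h
      rw [hvB (hbC' h)]
  · obtain ⟨a, rfl⟩ | ⟨b, rfl⟩ := Types.eq_or_eq_of_isPushout hTop c
    · exact ⟨a, rfl, haC' ((eC a).symm.trans h)⟩
    · obtain ⟨i, rfl, hi⟩ := lift a' b (h.symm.trans (eD b))
      exact ⟨iA i, eTop i, (eA i).trans hi⟩
end

section
/- In the category of sets, consider a commuting diagram consisting of maps I → A → C and J → B → D together with vertical maps I → J, A → B, C → D, such that the outer rectangle (with sides I → C, I → J, C → D, J → D) is a pullback, the left square (I, A, J, B) is a pushout, and A → B and C → D are injective. Then the right square (A, C, B, D) is a pullback. -/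
open CategoryTheory CategoryTheory.Limits

/-- In the category of sets, given a commuting diagram of maps
`I → A → C` and `J → B → D` with vertical maps `I → J`, `A → B`, `C → D`, such that
the outer rectangle (sides `I → C`, `I → J`, `C → D`, `J → D`) is a pullback, the left
square `(I, A, J, B)` is a pushout, and `A → B` and `C → D` are injective, the right
square `(A, C, B, D)` is a pullback. -/
theorem statement5 {I A C J B D : Type}
    (ia : I ⟶ A) (ac : A ⟶ C) (ij : I ⟶ J) (jb : J ⟶ B) (bd : B ⟶ D)
    (ab : A ⟶ B) (cd : C ⟶ D)
    (hLeftComm : ia ≫ ab = ij ≫ jb)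
    (hRightComm : ac ≫ cd = ab ≫ bd)
    (hOuter : IsPullback (ia ≫ ac) ij cd (jb ≫ bd))
    (hLeft : IsPushout ia ij ab jb)
    (hab : Function.Injective ab) (hcd : Function.Injective cd) :
    IsPullback ac ab cd bd := by
  rw [Types.isPullback_iff]
  refine ⟨hRightComm, fun _ _ h ↦ hab h.2, fun c b hcb ↦ ?_⟩
  obtain ⟨a, rfl⟩ | ⟨j, rfl⟩ := Types.eq_or_eq_of_isPushout hLeft b
  · exact ⟨a, hcd ((ConcreteCategory.congr_hom hRightComm a).trans hcb.symm), rfl⟩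
  · obtain ⟨i, hic, hij⟩ := Types.exists_of_isPullback hOuter c j hcb
    exact ⟨ia i, hic, (ConcreteCategory.congr_hom hLeftComm i).trans (congrArg jb hij)⟩
end

section
/- Let 𝒞 be a small category. In the category of presheaves of sets on 𝒞, consider a commuting cube consisting of a top face with maps I → A, I → B, A → C, B → C, a bottom face with maps I' → A', I' → B', A' → C', B' → C', and vertical maps I → I', A → A', B → B', C → C'. Assume the top and bottom faces are pushouts, the face (I, B, I', B') is a pullback, and I' → B' is a monomorphism. Then the face (A, C, A', C') is a pullback. -/
open CategoryTheory CategoryTheory.Limits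

/-- In a commuting cube of types whose top and bottom faces are pushouts, whose face
`(I, B, I', B')` is a pullback, and such that `I' → B'` is a monomorphism, the face
`(A, C, A', C')` is a pullback. -/
theorem Types.isPullback_of_isPushout_of_isPullback_of_mono.{u} {I A B C I' A' B' C' : Type u}
    {iA : I ⟶ A} {iB : I ⟶ B} {aC : A ⟶ C} {bC : B ⟶ C}
    {iA' : I' ⟶ A'} {iB' : I' ⟶ B'} {aC' : A' ⟶ C'} {bC' : B' ⟶ C'}
    {vI : I ⟶ I'} {vA : A ⟶ A'} {vB : B ⟶ B'} {vC : C ⟶ C'}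
    (hTop : IsPushout iA iB aC bC) (hBot : IsPushout iA' iB' aC' bC')
    (sqC : aC ≫ vC = vA ≫ aC') (sqD : bC ≫ vC = vB ≫ bC')
    (hPB : IsPullback iB vI vB iB') [Mono iB'] :
    IsPullback aC vA vC aC' := by
  have : Mono iB := MorphismProperty.of_isPullback (P := .monomorphisms _) hPB.flip ‹Mono iB'›
  have haC : Mono aC := Adhesive.mono_of_isPushout_of_mono_right hTop
  have haC' : Mono aC' := Adhesive.mono_of_isPushout_of_mono_right hBot
  rw [mono_iff_injective] at haC haC'
  refine (Types.isPullback_iff ..).2 ⟨sqC, fun _ _ h => haC h.1, fun c a' hca => ?_⟩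
  obtain ⟨a, rfl⟩ | ⟨b, rfl, hb⟩ := Types.eq_or_eq_of_isPushout' hTop c
  · exact ⟨a, rfl, haC' ((ConcreteCategory.congr_hom sqC a).symm.trans hca)⟩
  · obtain ⟨i', -, hi'⟩ := Types.exists_of_isPullback
      (Adhesive.isPullback_of_isPushout_of_mono_right hBot) a' (vB b)
      (hca.symm.trans (ConcreteCategory.congr_hom sqD b))
    obtain ⟨i, hi, -⟩ := Types.exists_of_isPullback hPB b i' hi'.symm
    exact (hb ⟨i, hi⟩).elim

/-- In the category of presheaves of sets on a small category `𝒞`,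
given a commuting cube whose top and bottom faces are pushouts, whose face
`(I, B, I', B')` is a pullback, and such that `I' → B'` is a monomorphism, the face
`(A, C, A', C')` is a pullback. -/
theorem statement6 {𝒞 : Type} [SmallCategory 𝒞]
    {I A B C I' A' B' C' : 𝒞ᵒᵖ ⥤ Type}
    (iA : I ⟶ A) (iB : I ⟶ B) (aC : A ⟶ C) (bC : B ⟶ C)
    (iA' : I' ⟶ A') (iB' : I' ⟶ B') (aC' : A' ⟶ C') (bC' : B' ⟶ C')
    (vI : I ⟶ I') (vA : A ⟶ A') (vB : B ⟶ B') (vC : C ⟶ C')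
    (hTop : IsPushout iA iB aC bC) (hBot : IsPushout iA' iB' aC' bC')
    (sqA : iA ≫ vA = vI ≫ iA') (sqB : iB ≫ vB = vI ≫ iB')
    (sqC : aC ≫ vC = vA ≫ aC') (sqD : bC ≫ vC = vB ≫ bC')
    (hPB : IsPullback iB vI vB iB')
    (hmono : Mono iB') :
    IsPullback aC vA vC aC' := by
  exact IsPullback.of_forall_isPullback_app fun X =>
    Types.isPullback_of_isPushout_of_isPullback_of_mono
      (hTop.map ((evaluation _ _).obj X)) (hBot.map ((evaluation _ _).obj X))
      (NatTrans.congr_app sqC X) (NatTrans.congr_app sqD X) (hPB.app X)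
end
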